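/- arXiv:1810.07432 — 2 statements merged into one kernel-verified Lean document; each statement's English description precedes it below -/
import Mathlib

section
/- Let d ≥ 2 and let B ⊆ A be linear subspaces of ℝ^d with dim B = b and dim A = a, where 1 ≤ c < b ≤ a ≤ d and b < d. Suppose the Diophantine exponent ω(B) = ω is finite. Then for Lebesgue-almost every Θ ∈ ℝ^{(a−c)×c}, the c-dimensional subspace C(Θ) ⊂ A satisfies ω(C(Θ)) ≤ ω + (ω+1)(c−b)/(d−c) = (ω(d−b) + c − b)/(d−c). -/
open MeasureTheory Filter

noncomputable section

/-- The sup-norm of a vector in Euclidean space. -/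
def supNorm {d : ℕ} (w : EuclideanSpace ℝ (Fin d)) : ℝ := ⨆ i, |w i|

/-- The point of `ℝ^d` (with Euclidean metric) corresponding to an integer vector. -/
def intVec {d : ℕ} (z : Fin d → ℤ) : EuclideanSpace ℝ (Fin d) :=
  (WithLp.equiv 2 (Fin d → ℝ)).symm (fun i => (z i : ℝ))

/-- The irrationality measure function `ψ_B` of a linear subspace of `ℝ^d`:
`ψ_B(t) = inf { dist(z, B) : z ∈ ℤ^d, 1 ≤ |z| < t }`. -/
def psiSub {d : ℕ} (B : Submodule ℝ (EuclideanSpace ℝ (Fin d))) (t : ℝ) : ℝ :=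
  sInf ((fun z : Fin d → ℤ =>
      Metric.infDist (intVec z) (B : Set (EuclideanSpace ℝ (Fin d)))) ''
    {z | 1 ≤ supNorm (intVec z) ∧ supNorm (intVec z) < t})

/-- The Diophantine exponent of a linear subspace of `ℝ^d`:
`ω(B) = sup { γ : liminf_{t→∞} t^γ ψ_B(t) < ∞ }`, as an extended real number. -/
def diophExp {d : ℕ} (B : Submodule ℝ (EuclideanSpace ℝ (Fin d))) : EReal :=
  sSup {x : EReal | ∃ γ : ℝ, x = (γ : EReal) ∧
    Filter.liminf (fun t : ℝ => ENNReal.ofReal (t ^ γ * psiSub B t)) Filter.atTop < ⊤}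

/-- The graph subspace `C(Θ)` of an `(a-c)×c` matrix `Θ`, relative to an orthonormal
basis `e` of an `a`-dimensional subspace of `ℝ^d`:
`C(Θ) = { ∑ x_j e_j + ∑_i (∑_j θ_{ij} x_j) e_{c+i} : x ∈ ℝ^c }`. -/
def graphSub (d a c : ℕ) (hca : c ≤ a) (e : Fin a → EuclideanSpace ℝ (Fin d))
    (Θ : Fin (a - c) → Fin c → ℝ) : Submodule ℝ (EuclideanSpace ℝ (Fin d)) :=
  Submodule.span ℝ {v | ∃ x : Fin c → ℝ,
    v = (∑ j : Fin c, x j • e (Fin.castLE hca j)) +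
        ∑ i : Fin (a - c), (∑ j : Fin c, Θ i j * x j) • e ⟨c + i.1, by have := i.2; omega⟩}

theorem supNorm_intVec {d : ℕ} [NeZero d] (z : Fin d → ℤ) : supNorm (intVec z) = ‖z‖ := by
  apply le_antisymm
  · refine ciSup_le fun i => ?_
    simpa [intVec, Int.norm_eq_abs] using norm_le_pi_norm z i
  · refine (pi_norm_le_iff_of_nonneg (Real.iSup_nonneg fun i => abs_nonneg _)).2 fun i => ?_
    have := le_ciSup (f := fun i => |(intVec z) i|) (Set.finite_range _).bddAbove i
    simpa [intVec, Int.norm_eq_abs, supNorm] using this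

theorem intVec_sub {d : ℕ} (z w : Fin d → ℤ) : intVec (z - w) = intVec z - intVec w := by
  ext i; simp [intVec]

theorem norm_le_norm_intVec {d : ℕ} (z : Fin d → ℤ) : ‖z‖ ≤ ‖intVec z‖ := by
  refine (pi_norm_le_iff_of_nonneg (norm_nonneg _)).2 fun i => ?_
  simpa [intVec, Int.norm_eq_abs] using PiLp.norm_apply_le (intVec z) i

theorem norm_intVec_le {d : ℕ} (z : Fin d → ℤ) : ‖intVec z‖ ≤ d * ‖z‖ := by
  have h : intVec z = ∑ i, EuclideanSpace.single i (z i : ℝ) := by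
    ext j
    simp [intVec, Finset.sum_apply, Pi.single_apply]
  calc ‖intVec z‖ ≤ ∑ i, ‖EuclideanSpace.single i (z i : ℝ)‖ := h ▸ norm_sum_le _ _
    _ ≤ ∑ _i : Fin d, ‖z‖ := Finset.sum_le_sum fun i _ => by
        simpa [Int.norm_eq_abs] using norm_le_pi_norm z i
    _ = d * ‖z‖ := by simp

theorem one_le_norm_of_ne_zero {d : ℕ} {z : Fin d → ℤ} (hz : z ≠ 0) : 1 ≤ ‖z‖ := by
  obtain ⟨i, hi⟩ := Function.ne_iff.1 hz
  refine le_trans ?_ (norm_le_pi_norm z i)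
  rw [Int.norm_eq_abs]
  exact_mod_cast Int.one_le_abs hi

theorem psiSub_le {d : ℕ} [NeZero d] (B : Submodule ℝ (EuclideanSpace ℝ (Fin d))) {t : ℝ}
    {z : Fin d → ℤ} (hz : z ≠ 0) (ht : ‖z‖ < t) :
    psiSub B t ≤ Metric.infDist (intVec z) (B : Set (EuclideanSpace ℝ (Fin d))) :=
  csInf_le ⟨0, by rintro _ ⟨w, -, rfl⟩; exact Metric.infDist_nonneg⟩
    ⟨z, by simpa [supNorm_intVec] using ⟨one_le_norm_of_ne_zero hz, ht⟩, rfl⟩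

theorem le_psiSub {d : ℕ} [NeZero d] (B : Submodule ℝ (EuclideanSpace ℝ (Fin d))) {t m : ℝ}
    (ht : 1 < t) (h : ∀ z : Fin d → ℤ, z ≠ 0 → ‖z‖ < t →
      m ≤ Metric.infDist (intVec z) (B : Set (EuclideanSpace ℝ (Fin d)))) :
    m ≤ psiSub B t := by
  refine le_csInf ⟨_, fun _ => 1, ?_, rfl⟩ ?_
  · simpa [supNorm_intVec, pi_norm_const] using ht
  · rintro _ ⟨z, ⟨h1, h2⟩, rfl⟩
    rw [supNorm_intVec] at h1 h2
    exact h z (by rintro rfl; norm_num at h1) h2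

/-- Every nonzero integer point `z` has distance at least `κ |z|^(-γ)` to `B`. -/
def IsBadlyApproximable {d : ℕ} (B : Submodule ℝ (EuclideanSpace ℝ (Fin d))) (γ κ : ℝ) : Prop :=
  ∀ z : Fin d → ℤ, z ≠ 0 →
    κ * ‖z‖ ^ (-γ) ≤ Metric.infDist (intVec z) (B : Set (EuclideanSpace ℝ (Fin d)))

theorem exists_isBadlyApproximable {d : ℕ} [NeZero d]
    {B : Submodule ℝ (EuclideanSpace ℝ (Fin d))} {γ : ℝ} (h : diophExp B < γ) :
    ∃ κ > 0, IsBadlyApproximable B γ κ := by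
  have h1 : liminf (fun t : ℝ => ENNReal.ofReal (t ^ γ * psiSub B t)) atTop = ⊤ := by
    by_contra hne
    have hle : (γ : EReal) ≤ diophExp B := le_sSup ⟨γ, rfl, lt_top_iff_ne_top.2 hne⟩
    exact not_le.2 h hle
  have h2 : ∀ᶠ t : ℝ in atTop, 1 < ENNReal.ofReal (t ^ γ * psiSub B t) :=
    eventually_lt_of_lt_liminf (by rw [h1]; exact ENNReal.one_lt_top)
  obtain ⟨t₀, ht₀⟩ := eventually_atTop.1 h2
  set s := 2 * max t₀ 1
  have hs : 2 ≤ s := by linarith [le_max_right t₀ 1]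
  have hs' : t₀ ≤ s := by linarith [le_max_left t₀ 1, le_max_right t₀ 1]
  refine ⟨s ^ (-γ), by positivity, fun z hz => ?_⟩
  have hz1 := one_le_norm_of_ne_zero hz
  have hlt := ht₀ (s * ‖z‖) (by nlinarith)
  rw [ENNReal.one_lt_ofReal] at hlt
  have hpos : 0 < (s * ‖z‖) ^ γ := by positivity
  rw [← Real.mul_rpow (by positivity) (by positivity), Real.rpow_neg (by positivity)]
  refine le_trans ?_ (psiSub_le B hz (t := s * ‖z‖) (by nlinarith))
  rw [inv_le_iff_one_le_mul₀ hpos]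
  linarith

theorem diophExp_le_of_isBadlyApproximable {d : ℕ} [NeZero d]
    {B : Submodule ℝ (EuclideanSpace ℝ (Fin d))} {γ κ : ℝ} (hγ : 0 ≤ γ) (hκ : 0 < κ)
    (h : IsBadlyApproximable B γ κ) : diophExp B ≤ γ := by
  refine sSup_le ?_
  rintro _ ⟨γ', rfl, hlt⟩
  by_contra! hcon
  have hγ' : γ < γ' := by exact_mod_cast hcon
  have h1 : ∀ᶠ t : ℝ in atTop, κ * t ^ (γ' - γ) ≤ t ^ γ' * psiSub B t := by
    filter_upwards [eventually_gt_atTop 1] with t ht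
    have hb : κ * t ^ (-γ) ≤ psiSub B t := le_psiSub B ht fun z hz hzt => by
      refine le_trans ?_ (h z hz)
      have := one_le_norm_of_ne_zero hz
      gcongr κ * ?_
      exact Real.rpow_le_rpow_of_nonpos (by linarith) hzt.le (by linarith)
    calc κ * t ^ (γ' - γ) = t ^ γ' * (κ * t ^ (-γ)) := by
          rw [sub_eq_add_neg, Real.rpow_add (by linarith)]; ring
      _ ≤ _ := by gcongr
  have h2 : Tendsto (fun t : ℝ => κ * t ^ (γ' - γ)) atTop atTop :=
    (tendsto_rpow_atTop (by linarith)).const_mul_atTop hκ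
  have h3 := ENNReal.tendsto_ofReal_atTop.comp (tendsto_atTop_mono' _ h1 h2)
  exact hlt.ne h3.liminf_eq

/-- The points of the ball of radius `T` can be labelled by few labels such that the projections to
`V` of equally labelled points are close. -/
theorem exists_label {E : Type*} [NormedAddCommGroup E] [InnerProductSpace ℝ E]
    [FiniteDimensional ℝ E] (V : Submodule ℝ E) {n : ℕ} (hn : Module.finrank ℝ V = n) {r T : ℝ}
    (hr : 0 < r) (hrT : r ≤ T) :
    ∃ (F : Finset (Fin n → ℤ)) (l : E → Fin n → ℤ), (F.card : ℝ) ≤ (5 * T / r) ^ n ∧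
      (∀ p, ‖p‖ ≤ T → l p ∈ F) ∧
      ∀ p q, l p = l q → ‖V.starProjection (p - q)‖ ≤ n * r := by
  subst hn
  set f := stdOrthonormalBasis ℝ V
  have hf : ∀ i, ‖(f i : E)‖ = 1 := fun i => f.orthonormal.1 i
  set N : ℤ := ⌈T / r⌉
  have hTr : 1 ≤ T / r := by rwa [one_le_div hr]
  have hN : (N : ℝ) < T / r + 1 := Int.ceil_lt_add_one _
  have hN0 : 0 ≤ N := Int.ceil_nonneg (by linarith)
  refine ⟨Fintype.piFinset fun _ => Finset.Icc (-N) N, fun p i => ⌊inner ℝ (f i : E) p / r⌋,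
    ?_, fun p hp => ?_, fun p q hpq => ?_⟩
  · rw [Fintype.card_piFinset_const, Int.card_Icc]
    push_cast
    refine pow_le_pow_left₀ (by positivity) ?_ _
    have : (((N + 1 - -N).toNat : ℤ) : ℝ) = 2 * N + 1 := by
      rw [Int.toNat_of_nonneg (by omega)]; push_cast; ring
    rw [Int.cast_natCast] at this
    rw [this, mul_div_assoc]
    linarith
  · simp only [Fintype.mem_piFinset, Finset.mem_Icc]
    intro i
    have h1 : |inner ℝ (f i : E) p| ≤ T :=
      (abs_real_inner_le_norm _ _).trans (by rw [hf, one_mul]; exact hp)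
    have h2 : |inner ℝ (f i : E) p / r| ≤ T / r := by
      rw [abs_div, abs_of_pos hr]; gcongr
    have h3 : T / r ≤ N := Int.le_ceil _
    rw [abs_le] at h2
    constructor
    · rw [Int.le_floor]; push_cast; linarith
    · have := Int.floor_le (inner ℝ (f i : E) p / r)
      exact_mod_cast this.trans (h2.2.trans h3)
  · rw [f.starProjection_eq_sum_rankOne]
    simp only [sum_apply, InnerProductSpace.rankOne_apply]
    refine (norm_sum_le _ _).trans ?_
    refine (Finset.sum_le_card_nsmul _ _ r fun i _ => ?_).trans (by simp)
    rw [norm_smul, hf, mul_one, inner_sub_right, Real.norm_eq_abs]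
    have h := Int.abs_sub_lt_one_of_floor_eq_floor (congrFun hpq i)
    rw [← sub_div, abs_div, abs_of_pos hr, div_lt_one hr] at h
    exact h.le

theorem card_le_of_separated {d a b : ℕ} [NeZero d]
    {A B : Submodule ℝ (EuclideanSpace ℝ (Fin d))} (hBA : B ≤ A)
    (hB : Module.finrank ℝ B = b) (hA : Module.finrank ℝ A = a) (S : Finset (Fin d → ℤ))
    {T R η : ℝ} (hη : 0 < η) (hηR : η ≤ R) (hRT : R ≤ T)
    (hsep : ∀ w : Fin d → ℤ, w ≠ 0 → ‖w‖ ≤ 4 * R →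
      3 * η ≤ Metric.infDist (intVec w) (B : Set (EuclideanSpace ℝ (Fin d))))
    (hS : ∀ z ∈ S, ‖z‖ ≤ 2 * T ∧
      Metric.infDist (intVec z) (A : Set (EuclideanSpace ℝ (Fin d))) < η) :
    (S.card : ℝ) ≤ (15 * d ^ 2 * (T / R)) ^ b * (15 * d ^ 2 * (T / η)) ^ (a - b) := by
  have hR : 0 < R := hη.trans_le hηR
  have hT : 0 < T := hR.trans_le hRT
  have hd : (1 : ℝ) ≤ d := by exact_mod_cast NeZero.one_le
  have hd0 : (0 : ℝ) < d := by linarith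
  set V := Bᗮ ⊓ A
  have hV : Module.finrank ℝ V = a - b := by
    have := Submodule.finrank_add_inf_finrank_orthogonal hBA
    rw [hB, hA] at this
    exact Nat.eq_sub_of_add_eq' this
  have hbd : (b : ℝ) ≤ d := by
    have := Submodule.finrank_le B
    simp only [finrank_euclideanSpace, Fintype.card_fin] at this
    exact_mod_cast hB ▸ this
  have had : ((a - b : ℕ) : ℝ) ≤ d := by
    have := Submodule.finrank_le V
    simp only [finrank_euclideanSpace, Fintype.card_fin] at this
    exact_mod_cast hV ▸ this
  have hle : ∀ x : ℝ, 0 < x → x ≤ T → x / d ≤ 3 * d * T := fun x hx hxT => by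
    rw [div_le_iff₀ hd0]
    nlinarith [mul_le_mul hd hd zero_le_one hd0.le]
  obtain ⟨F, l, hF, hlF, hl⟩ := exists_label B hB (r := R / d) (T := 3 * d * T)
    (by positivity) (hle _ hR hRT)
  obtain ⟨G, m, hG, hmG, hm⟩ := exists_label V hV (r := η / d) (T := 3 * d * T)
    (by positivity) (hle _ hη (hηR.trans hRT))
  have hp : ∀ z : Fin d → ℤ, ∃ p, z ∈ S → p ∈ A ∧ ‖intVec z - p‖ < η := fun z => by
    by_cases hz : z ∈ S
    · obtain ⟨p, hp, hd⟩ := (Metric.infDist_lt_iff ⟨0, A.zero_mem⟩).1 (hS z hz).2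
      exact ⟨p, fun _ => ⟨hp, by rwa [← dist_eq_norm]⟩⟩
    · exact ⟨0, fun h => absurd h hz⟩
  choose p hp using hp
  have hpn : ∀ z ∈ S, ‖p z‖ ≤ 3 * d * T := fun z hz => by
    have h1 := norm_intVec_le z
    have h2 : d * ‖z‖ ≤ d * (2 * T) := by gcongr; exact (hS z hz).1
    have h3 := norm_sub_norm_le (p z) (intVec z)
    rw [norm_sub_rev] at h3
    have h4 := (hp z hz).2
    nlinarith
  have hcard : S.card ≤ (F ×ˢ G).card := by
    refine Finset.card_le_card_of_injOn (fun z => (l (p z), m (p z))) (fun z hz => ?_) ?_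
    · exact Finset.mem_product.2 ⟨hlF _ (hpn z hz), hmG _ (hpn z hz)⟩
    intro z hz z' hz' heq
    by_contra hne
    simp only [Prod.mk.injEq] at heq
    obtain ⟨hzA, hzp⟩ := hp z hz
    obtain ⟨hzA', hzp'⟩ := hp z' hz'
    set P := p z - p z' with hPdef
    have hPA : P ∈ A := A.sub_mem hzA hzA'
    set q := B.starProjection P with hq
    have hqB : q ∈ B := B.starProjection_apply_mem P
    have h1 : ‖q‖ ≤ R := (hl _ _ heq.1).trans (by
      rw [mul_div_assoc', div_le_iff₀ hd0]; nlinarith)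
    have hqV : V.starProjection P = P - q := by
      have hm1 : P - q ∈ V := ⟨B.sub_starProjection_mem_orthogonal P, A.sub_mem hPA (hBA hqB)⟩
      have hm2 : V.starProjection q = 0 := by
        rw [Submodule.starProjection_apply_eq_zero_iff]
        exact Submodule.orthogonal_le (inf_le_left : V ≤ Bᗮ) (B.le_orthogonal_orthogonal hqB)
      have hm3 := Submodule.starProjection_eq_self_iff.2 hm1
      rwa [map_sub, hm2, sub_zero] at hm3
    have h2 : ‖P - q‖ ≤ η := hqV ▸ (hm _ _ heq.2).trans (by
      rw [mul_div_assoc', div_le_iff₀ hd0]; nlinarith)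
    have h3 : ‖intVec (z - z') - P‖ < 2 * η := by
      have : intVec (z - z') - P = (intVec z - p z) - (intVec z' - p z') := by
        rw [intVec_sub, hPdef]; abel
      rw [this]
      linarith [norm_sub_le (intVec z - p z) (intVec z' - p z')]
    have h4 : ‖intVec (z - z') - q‖ < 3 * η := by
      have := norm_add_le (intVec (z - z') - P) (P - q)
      rw [sub_add_sub_cancel] at this
      linarith
    have h5 : ‖z - z'‖ ≤ 4 * R := by
      have := norm_le_norm_intVec (z - z')
      have := norm_add_le (intVec (z - z') - q) q
      rw [sub_add_cancel] at this
      linarith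
    have h6 := hsep _ (sub_ne_zero.2 hne) h5
    have h7 := Metric.infDist_le_dist_of_mem (x := intVec (z - z')) hqB
    rw [dist_eq_norm] at h7
    linarith
  calc (S.card : ℝ) ≤ F.card * G.card := by
        rw [Finset.card_product] at hcard; exact_mod_cast hcard
    _ ≤ (5 * (3 * d * T) / (R / d)) ^ b * (5 * (3 * d * T) / (η / d)) ^ (a - b) := by
        gcongr
    _ = _ := by
        congr 2 <;> field_simp <;> ring

theorem IsBadlyApproximable.le_infDist {d : ℕ} {B : Submodule ℝ (EuclideanSpace ℝ (Fin d))}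
    {γ κ κ' R : ℝ} (h : IsBadlyApproximable B γ κ) (hγ : 0 ≤ γ) (hκ : 0 < κ) (hR : 0 < R)
    (hκ' : κ' ≤ κ * 4 ^ (-γ) / 3) {w : Fin d → ℤ} (hw : w ≠ 0) (hwR : ‖w‖ ≤ 4 * R) :
    3 * (κ' * R ^ (-γ)) ≤ Metric.infDist (intVec w) (B : Set (EuclideanSpace ℝ (Fin d))) := by
  refine le_trans ?_ (h w hw)
  have h1 := one_le_norm_of_ne_zero hw
  have h2 : (4 * R) ^ (-γ) ≤ ‖w‖ ^ (-γ) :=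
    Real.rpow_le_rpow_of_nonpos (by linarith) hwR (by linarith)
  rw [Real.mul_rpow (by norm_num) hR.le] at h2
  calc 3 * (κ' * R ^ (-γ)) ≤ 3 * (κ * 4 ^ (-γ) / 3 * R ^ (-γ)) := by gcongr
    _ = κ * (4 ^ (-γ) * R ^ (-γ)) := by ring
    _ ≤ _ := by gcongr

theorem IsBadlyApproximable.le_exponent {d b : ℕ} [NeZero d]
    {B : Submodule ℝ (EuclideanSpace ℝ (Fin d))} {γ κ : ℝ} (h : IsBadlyApproximable B γ κ)
    (hγ : 0 ≤ γ) (hκ : 0 < κ) (hB : Module.finrank ℝ B = b) (hbd : b ≤ d) :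
    (b : ℝ) ≤ γ * (d - b) := by
  by_contra! hcon
  set κ' := min 1 (κ * 4 ^ (-γ) / 3)
  have hκ' : 0 < κ' := by positivity
  set C : ℝ := (15 * d ^ 2) ^ b * (15 * d ^ 2 / κ') ^ (d - b)
  have key : ∀ n : ℕ, 1 ≤ n → (n : ℝ) ^ (b - γ * (d - b)) ≤ C := fun n hn => by
    have hn1 : (1 : ℝ) ≤ n := by exact_mod_cast hn
    have hn0 : (0 : ℝ) < n := by linarith
    have hη : κ' * (n : ℝ) ^ (-γ) ≤ n := by
      have : (n : ℝ) ^ (-γ) ≤ 1 := Real.rpow_le_one_of_one_le_of_nonpos hn1 (by linarith)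
      nlinarith [min_le_left 1 (κ * 4 ^ (-γ) / 3)]
    have hc := card_le_of_separated (A := ⊤) (a := d) le_top hB (by simp)
      (Fintype.piFinset fun _ : Fin d => Finset.Icc (1 : ℤ) n) (by positivity) hη le_rfl
      (fun w hw hwR => h.le_infDist hγ hκ hn0 (min_le_right _ _) hw hwR) (fun z hz => by
        simp only [Fintype.mem_piFinset, Finset.mem_Icc] at hz
        refine ⟨(pi_norm_le_iff_of_nonneg (by positivity)).2 fun i => ?_, ?_⟩
        · have h1 : (1 : ℝ) ≤ z i := by exact_mod_cast (hz i).1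
          have h2 : (z i : ℝ) ≤ n := by exact_mod_cast (hz i).2
          rw [Int.norm_eq_abs, abs_le]
          constructor <;> linarith
        · rw [Metric.infDist_zero_of_mem (by simp)]; positivity)
    rw [Fintype.card_piFinset_const, Int.card_Icc, div_self hn0.ne', mul_one] at hc
    simp only [add_sub_cancel_right, Int.toNat_natCast, Nat.cast_pow] at hc
    have e1 : (n : ℝ) / (κ' * (n : ℝ) ^ (-γ)) = n ^ (1 + γ) / κ' := by
      rw [Real.rpow_neg hn0.le, Real.rpow_add hn0, Real.rpow_one]
      field_simp
    have e2 : (15 * d ^ 2 * ((n : ℝ) ^ (1 + γ) / κ')) ^ (d - b) =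
        (15 * d ^ 2 / κ') ^ (d - b) * n ^ ((1 + γ) * (d - b)) := by
      rw [← Nat.cast_sub hbd, Real.rpow_mul hn0.le, Real.rpow_natCast, ← mul_pow]
      congr 1; ring
    rw [e1, e2, ← mul_assoc] at hc
    have e3 : (n : ℝ) ^ (b - γ * (d - b)) = n ^ d / n ^ ((1 + γ) * (d - b)) := by
      rw [← Real.rpow_natCast, ← Real.rpow_sub hn0]
      congr 1; ring
    rwa [e3, div_le_iff₀ (by positivity)]
  have ht := (tendsto_rpow_atTop (sub_pos.2 hcon)).comp tendsto_natCast_atTop_atTop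
  obtain ⟨n, hn, hn1⟩ := ((ht.eventually_gt_atTop C).and (eventually_ge_atTop 1)).exists
  exact absurd (key n hn1) (not_le.2 hn)

theorem volume_slab_le {n : ℕ} (M : ℝ) (x : Fin n → ℝ) (j : Fin n) (hx : x j ≠ 0) (w s : ℝ) :
    volume {v : Fin n → ℝ | (∀ k, |v k| ≤ M) ∧ |∑ k, v k * x k - w| ≤ s} ≤
      ENNReal.ofReal (2 * (s / |x j|)) * ENNReal.ofReal (2 * M) ^ (n - 1) := by
  obtain ⟨m, rfl⟩ : ∃ m, n = m + 1 := ⟨n - 1, by have := j.pos; omega⟩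
  set S : Set (ℝ × (Fin m → ℝ)) := {p | (∀ k, |p.2 k| ≤ M) ∧
    |p.1 * x j + ∑ k, p.2 k * x (j.succAbove k) - w| ≤ s}
  have hSc : IsClosed S := by
    have h1 : IsClosed {p : ℝ × (Fin m → ℝ) | ∀ k, |p.2 k| ≤ M} := by
      simp only [Set.ofPred_forall]
      exact isClosed_iInter fun k =>
        isClosed_le (f := fun p : ℝ × (Fin m → ℝ) => |p.2 k|) (by fun_prop) continuous_const
    exact h1.inter (isClosed_le (f := fun p : ℝ × (Fin m → ℝ) =>
      |p.1 * x j + ∑ k, p.2 k * x (j.succAbove k) - w|) (by fun_prop) continuous_const)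
  have hmp := volume_preserving_piFinSuccAbove (fun _ : Fin (m + 1) => ℝ) j
  calc _ ≤ volume (MeasurableEquiv.piFinSuccAbove (fun _ : Fin (m + 1) => ℝ) j ⁻¹' S) := by
        refine measure_mono fun v hv => ⟨fun k => hv.1 _, ?_⟩
        have := hv.2
        rw [Fin.sum_univ_succAbove _ j] at this
        exact this
    _ = volume S := hmp.measure_preimage hSc.measurableSet.nullMeasurableSet
    _ = ∫⁻ v : Fin m → ℝ, volume ((fun u => (u, v)) ⁻¹' S) := by
        rw [Measure.volume_eq_prod, Measure.prod_apply_symm hSc.measurableSet]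
    _ ≤ ∫⁻ v : Fin m → ℝ, (Set.pi Set.univ fun _ : Fin m => Set.Icc (-M) M).indicator
          (fun _ => ENNReal.ofReal (2 * (s / |x j|))) v := by
        refine lintegral_mono fun v => ?_
        by_cases hv : v ∈ Set.pi Set.univ fun _ : Fin m => Set.Icc (-M) M
        · rw [Set.indicator_of_mem hv, ← Real.volume_closedBall
            ((w - ∑ k, v k * x (j.succAbove k)) / x j)]
          refine measure_mono fun u hu => ?_
          have hu2 : |u * x j + ∑ k, v k * x (j.succAbove k) - w| ≤ s := hu.2
          rw [Metric.mem_closedBall, Real.dist_eq, le_div_iff₀ (abs_pos.2 hx), ← abs_mul]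
          refine le_of_eq_of_le ?_ hu2
          congr 1
          field_simp
          ring
        · rw [Set.indicator_of_notMem hv]
          refine le_of_eq (measure_mono_null (t := ∅) (fun u hu => hv fun k _ => ?_) measure_empty)
          exact abs_le.1 (hu.1 k)
    _ = _ := by
        rw [lintegral_indicator_const (MeasurableSet.univ_pi fun _ => measurableSet_Icc),
          volume_pi_pi]
        simp only [Real.volume_Icc, Finset.prod_const, Finset.card_univ, Fintype.card_fin,
          sub_neg_eq_add, ← two_mul, Nat.add_sub_cancel]

theorem mem_graphSub {d a c : ℕ} {hca : c ≤ a} {e : Fin a → EuclideanSpace ℝ (Fin d)}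
    {Θ : Fin (a - c) → Fin c → ℝ} {v : EuclideanSpace ℝ (Fin d)} (hv : v ∈ graphSub d a c hca e Θ) :
    ∃ x : Fin c → ℝ, v = (∑ j : Fin c, x j • e (Fin.castLE hca j)) +
      ∑ i : Fin (a - c), (∑ j : Fin c, Θ i j * x j) • e ⟨c + i.1, by have := i.2; omega⟩ := by
  induction hv using Submodule.span_induction with
  | mem v hv => exact hv
  | zero => exact ⟨0, by simp⟩
  | add u v _ _ hu hv =>
    obtain ⟨x, rfl⟩ := hu
    obtain ⟨y, rfl⟩ := hv
    refine ⟨x + y, ?_⟩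
    simp only [Pi.add_apply, mul_add, add_smul, Finset.sum_add_distrib]
    abel
  | smul r u _ hu =>
    obtain ⟨x, rfl⟩ := hu
    refine ⟨r • x, ?_⟩
    simp only [Pi.smul_apply, smul_eq_mul, smul_add, Finset.smul_sum, smul_smul, Finset.mul_sum,
      mul_left_comm]

theorem graphSub_le {d a c : ℕ} (hca : c ≤ a) (e : Fin a → EuclideanSpace ℝ (Fin d))
    (Θ : Fin (a - c) → Fin c → ℝ) :
    graphSub d a c hca e Θ ≤ Submodule.span ℝ (Set.range e) := by
  refine Submodule.span_le.2 ?_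
  rintro _ ⟨x, rfl⟩
  have he : ∀ k, e k ∈ Submodule.span ℝ (Set.range e) := fun k =>
    Submodule.subset_span ⟨k, rfl⟩
  exact Submodule.add_mem _ (Submodule.sum_mem _ fun j _ => Submodule.smul_mem _ _ (he _))
    (Submodule.sum_mem _ fun i _ => Submodule.smul_mem _ _ (he _))

theorem abs_sum_mul_le {n : ℕ} {M : ℝ} {v : Fin n → ℝ} (hv : ∀ k, |v k| ≤ M) (x : Fin n → ℝ) :
    |∑ k, v k * x k| ≤ n * M * ‖x‖ := by
  refine (Finset.abs_sum_le_sum_abs _ _).trans ?_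
  refine (Finset.sum_le_card_nsmul _ _ (M * ‖x‖) fun k _ => ?_).trans (by simp [mul_assoc])
  rw [abs_mul]
  exact mul_le_mul (hv k) (norm_le_pi_norm x k) (abs_nonneg _) ((abs_nonneg _).trans (hv k))

theorem exists_norm_eq_abs_apply {n : ℕ} (hn : 1 ≤ n) (x : Fin n → ℝ) : ∃ j, ‖x‖ = |x j| := by
  have : Nonempty (Fin n) := ⟨⟨0, hn⟩⟩
  obtain ⟨j, hj⟩ := Finite.exists_max fun j => |x j|
  exact ⟨j, le_antisymm ((pi_norm_le_iff_of_nonneg (abs_nonneg _)).2 hj) (norm_le_pi_norm x j)⟩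

/-- If `z` is close to `C(Θ)` then its coordinates satisfy the linear system defining `C(Θ)` up to
a small error, and its first `c` coordinates are not all small. -/
theorem graphSub_approx {d a c : ℕ} (hca : c ≤ a)
    {e : Fin a → EuclideanSpace ℝ (Fin d)} (he : Orthonormal ℝ e) {M : ℝ}
    {Θ : Fin (a - c) → Fin c → ℝ} (hΘ : ∀ i j, |Θ i j| ≤ M) {z : EuclideanSpace ℝ (Fin d)} {η : ℝ}
    (hz : Metric.infDist z (graphSub d a c hca e Θ : Set (EuclideanSpace ℝ (Fin d))) < η) :
    ‖z‖ ≤ (c + (a - c : ℕ) * (c * M)) * (‖fun j => inner ℝ (e (Fin.castLE hca j)) z‖ + η) + η ∧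
    ∀ i : Fin (a - c), |∑ j : Fin c, Θ i j * inner ℝ (e (Fin.castLE hca j)) z -
      inner ℝ (e ⟨c + i.1, by have := i.2; omega⟩) z| ≤ (c * M + 1) * η := by
  obtain ⟨p, hp, hzp⟩ := (Metric.infDist_lt_iff ⟨0, Submodule.zero_mem _⟩).1 hz
  rw [dist_eq_norm] at hzp
  obtain ⟨x, hx⟩ := mem_graphSub hp
  have hη : 0 < η := (norm_nonneg _).trans_lt hzp
  have hee := orthonormal_iff_ite.1 he
  have hin : ∀ k, |inner ℝ (e k) z - inner ℝ (e k) p| ≤ η := fun k => by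
    rw [← inner_sub_right]
    refine (abs_real_inner_le_norm _ _).trans ?_
    rw [he.1 k, one_mul]; exact hzp.le
  have hp1 : ∀ j : Fin c, inner ℝ (e (Fin.castLE hca j)) p = x j := fun j => by
    rw [hx, inner_add_right, inner_sum, inner_sum]
    simp only [inner_smul_right, hee, (Fin.castLE_injective hca).eq_iff]
    rw [Finset.sum_eq_zero (s := Finset.univ (α := Fin (a - c)))]
    · simp
    · intro i _
      rw [if_neg, mul_zero]
      rw [Fin.ext_iff, Fin.val_castLE]
      have := j.2
      simp only; omega
  have hp2 : ∀ i : Fin (a - c), inner ℝ (e ⟨c + i.1, by have := i.2; omega⟩) p =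
      ∑ j, Θ i j * x j := fun i => by
    rw [hx, inner_add_right, inner_sum, inner_sum]
    simp only [inner_smul_right, hee, Fin.mk.injEq, Nat.add_left_cancel_iff, Fin.val_inj]
    rw [Finset.sum_eq_zero (s := Finset.univ (α := Fin c))]
    · simp
    · intro j _
      rw [if_neg, mul_zero]
      rw [Fin.ext_iff, Fin.val_castLE]
      have := j.2
      simp only; omega
  set y : Fin c → ℝ := fun j => inner ℝ (e (Fin.castLE hca j)) z with hy
  have hyx : ‖y - x‖ ≤ η := (pi_norm_le_iff_of_nonneg hη.le).2 fun j => by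
    simpa [hy, hp1] using hin (Fin.castLE hca j)
  have hxy : ‖x‖ ≤ ‖y‖ + η := by
    have := norm_sub_norm_le x y
    rw [norm_sub_rev] at this
    linarith
  constructor
  · have h1 : ‖p‖ ≤ (c + (a - c : ℕ) * (c * M)) * ‖x‖ := by
      rw [hx, add_mul]
      refine (norm_add_le _ _).trans (add_le_add ?_ ?_)
      · refine (norm_sum_le _ _).trans ?_
        refine (Finset.sum_le_card_nsmul _ _ ‖x‖ fun j _ => ?_).trans (by simp)
        rw [norm_smul, he.1, mul_one]
        exact norm_le_pi_norm x j
      · refine (norm_sum_le _ _).trans ?_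
        refine (Finset.sum_le_card_nsmul _ _ (c * M * ‖x‖) fun i _ => ?_).trans
          (by simp [mul_assoc])
        rw [norm_smul, he.1, mul_one]
        exact abs_sum_mul_le (hΘ i) x
    have h2 := norm_sub_norm_le z p
    have h3 : (c + (a - c : ℕ) * (c * M)) * ‖x‖ ≤ (c + (a - c : ℕ) * (c * M)) * (‖y‖ + η) := by
      rcases Nat.eq_zero_or_pos (a - c) with h0 | h0
      · rw [h0]
        simp only [Nat.cast_zero, zero_mul, add_zero]
        gcongr
      · rcases Nat.eq_zero_or_pos c with h0' | h0'
        · simp [h0']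
        · have : 0 ≤ M := (abs_nonneg _).trans (hΘ ⟨0, h0⟩ ⟨0, h0'⟩)
          gcongr
    linarith
  · intro i
    have h1 := abs_sum_mul_le (hΘ i) (y - x)
    have h2 := hin ⟨c + i.1, by have := i.2; omega⟩
    rw [hp2, abs_sub_comm] at h2
    have h3 : ∑ j, Θ i j * (y - x) j = ∑ j, Θ i j * y j - ∑ j, Θ i j * x j := by
      simp [mul_sub, Finset.sum_sub_distrib]
    rw [h3] at h1
    have h4 : c * M * ‖y - x‖ ≤ c * M * η := by
      rcases Nat.eq_zero_or_pos c with h0' | h0'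
      · simp [h0']
      · have : 0 ≤ M := (abs_nonneg _).trans (hΘ i ⟨0, h0'⟩)
        gcongr
    refine (abs_sub_le _ (∑ j, Θ i j * x j) _).trans ?_
    linarith

theorem exists_volume_graphSub_le {d a c : ℕ} (hca : c ≤ a) (hc : 1 ≤ c)
    {e : Fin a → EuclideanSpace ℝ (Fin d)} (he : Orthonormal ℝ e) {M : ℝ} (hM : 0 ≤ M) :
    ∃ K > 0, ∃ κ > 0, ∀ z : Fin d → ℤ, z ≠ 0 → ∀ η ≤ κ,
      volume {Θ : Fin (a - c) → Fin c → ℝ | (∀ i j, |Θ i j| ≤ M) ∧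
        Metric.infDist (intVec z)
          (graphSub d a c hca e Θ : Set (EuclideanSpace ℝ (Fin d))) < η} ≤
      ENNReal.ofReal (K * (η / ‖z‖)) ^ (a - c) := by
  have hc' : (1 : ℝ) ≤ c := by exact_mod_cast hc
  set L : ℝ := c + (a - c : ℕ) * (c * M) with hL
  have hL0 : 0 < L := by positivity
  refine ⟨4 * L * (c * M + 1) * (2 * M + 1) ^ (c - 1), by positivity, 1 / (2 * (L + 1)),
    by positivity, fun z hz η hη => ?_⟩
  set y : Fin c → ℝ := fun j => inner ℝ (e (Fin.castLE hca j)) (intVec z) with hy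
  have hz1 := one_le_norm_of_ne_zero hz
  have hz2 := norm_le_norm_intVec z
  rw [le_div_iff₀ (by positivity)] at hη
  by_cases hne : ‖z‖ ≤ 2 * L * ‖y‖
  swap
  · refine le_of_eq_of_le (measure_mono_null (t := ∅) (fun Θ hΘ => hne ?_) measure_empty) zero_le
    have := (graphSub_approx hca he hΘ.1 hΘ.2).1
    nlinarith
  obtain ⟨j, hj⟩ := exists_norm_eq_abs_apply hc y
  rw [hj] at hne
  have hj0 : 0 < |y j| := by
    by_contra! h
    nlinarith [abs_nonneg (y j)]
  have hrow : ∀ i : Fin (a - c), volume {v : Fin c → ℝ | (∀ k, |v k| ≤ M) ∧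
      |∑ k, v k * y k - inner ℝ (e ⟨c + i.1, by have := i.2; omega⟩) (intVec z)| ≤
        (c * M + 1) * η} ≤
      ENNReal.ofReal (4 * L * (c * M + 1) * (2 * M + 1) ^ (c - 1) * (η / ‖z‖)) := fun i => by
    rcases lt_or_ge η 0 with hη0 | hη0
    · refine le_of_eq_of_le (measure_mono_null (t := ∅) (fun v hv => ?_) measure_empty) zero_le
      have h1 := (abs_nonneg _).trans hv.2
      have : 0 < c * M + 1 := by positivity
      nlinarith
    refine (volume_slab_le M y j (abs_pos.1 hj0) _ _).trans ?_
    rw [← ENNReal.ofReal_pow (by positivity), ← ENNReal.ofReal_mul (by positivity)]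
    refine ENNReal.ofReal_le_ofReal ?_
    have h1 : 1 / |y j| ≤ 2 * L / ‖z‖ := by
      rw [div_le_div_iff₀ hj0 (by linarith)]; linarith
    calc 2 * ((c * M + 1) * η / |y j|) * (2 * M) ^ (c - 1)
        = 2 * (c * M + 1) * η * (1 / |y j|) * (2 * M) ^ (c - 1) := by ring
      _ ≤ 2 * (c * M + 1) * η * (2 * L / ‖z‖) * (2 * M + 1) ^ (c - 1) := by
          gcongr; linarith
      _ = _ := by ring
  calc _ ≤ volume (Set.pi Set.univ fun i : Fin (a - c) => {v : Fin c → ℝ | (∀ k, |v k| ≤ M) ∧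
      |∑ k, v k * y k - inner ℝ (e ⟨c + i.1, by have := i.2; omega⟩) (intVec z)| ≤
        (c * M + 1) * η}) :=
        measure_mono fun Θ hΘ i _ => ⟨hΘ.1 i, (graphSub_approx hca he hΘ.1 hΘ.2).2 i⟩
    _ ≤ _ := by
        rw [volume_pi_pi]
        exact (Finset.prod_le_pow_card _ _ _ fun i _ => hrow i).trans (by simp)

theorem infDist_intVec_smul_le {d : ℕ} (C : Submodule ℝ (EuclideanSpace ℝ (Fin d))) {n : ℕ}
    (hn : 0 < n) (z : Fin d → ℤ) :
    Metric.infDist (intVec ((n : ℤ) • z)) (C : Set (EuclideanSpace ℝ (Fin d))) / n ≤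
      Metric.infDist (intVec z) (C : Set (EuclideanSpace ℝ (Fin d))) := by
  have hn' : (0 : ℝ) < n := by exact_mod_cast hn
  refine (Metric.le_infDist ⟨0, C.zero_mem⟩).2 fun p hp => ?_
  have h1 : intVec ((n : ℤ) • z) = (n : ℝ) • intVec z := by ext i; simp [intVec]
  have h2 := Metric.infDist_le_dist_of_mem (x := intVec ((n : ℤ) • z))
    (C.smul_mem (n : ℝ) hp : (n : ℝ) • p ∈ (C : Set (EuclideanSpace ℝ (Fin d))))
  rw [h1, dist_smul₀, Real.norm_of_nonneg hn'.le] at h2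
  rw [div_le_iff₀ hn', h1]
  linarith

/-- A lower bound for the distances to `C` of all large enough integer points extends to all
nonzero integer points, with a smaller constant. -/
theorem IsBadlyApproximable.of_large {d : ℕ} {C : Submodule ℝ (EuclideanSpace ℝ (Fin d))}
    {γ κ : ℝ} (hκ : 0 < κ) {n : ℕ} (hn : 0 < n)
    (h : ∀ z : Fin d → ℤ, (n : ℝ) ≤ ‖z‖ →
      κ * ‖z‖ ^ (-γ) ≤ Metric.infDist (intVec z) (C : Set (EuclideanSpace ℝ (Fin d)))) :
    ∃ κ' > 0, IsBadlyApproximable C γ κ' := by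
  have hn' : (0 : ℝ) < n := by exact_mod_cast hn
  refine ⟨κ * n ^ (-γ) / n, by positivity, fun z hz => ?_⟩
  refine le_trans ?_ (infDist_intVec_smul_le C hn z)
  have hz1 := one_le_norm_of_ne_zero hz
  have hnz : ‖(n : ℤ) • z‖ = n * ‖z‖ := by
    rw [norm_smul]; simp
  have h1 := h ((n : ℤ) • z) (by rw [hnz]; nlinarith)
  rw [hnz, Real.mul_rpow hn'.le (norm_nonneg _)] at h1
  rw [le_div_iff₀ hn']
  refine le_of_eq_of_le ?_ h1
  field_simp

theorem finite_setOf_norm_le {d : ℕ} (T : ℝ) : {z : Fin d → ℤ | ‖z‖ ≤ T}.Finite := by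
  have : {z : Fin d → ℤ | ‖z‖ ≤ T} = Metric.closedBall 0 T := by ext; simp
  rw [this]
  exact (isCompact_closedBall _ _).finite_of_discrete

theorem count_mul_measure_eq (C K κ u : ℝ) {v : ℝ} (hv : v ≠ 0) (b m n : ℕ) :
    (C * u) ^ b * (C * (v / κ)) ^ m * (K * (κ / v)) ^ (m + n) =
      C ^ b * (C / κ) ^ m * (K * κ) ^ (m + n) * (u ^ b / v ^ n) := by
  have h1 : C * (v / κ) = C / κ * v := by ring
  have h2 : K * (κ / v) = K * κ / v := by ring
  rw [h1, h2, mul_pow C u, mul_pow (C / κ) v, div_pow (K * κ), pow_add v]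
  field_simp

theorem ae_isBadlyApproximable_of_bounded {d a b c : ℕ} [NeZero d] (hc : 1 ≤ c) (hcb : c < b)
    (hba : b ≤ a) {A B : Submodule ℝ (EuclideanSpace ℝ (Fin d))} (hBA : B ≤ A)
    (hB : Module.finrank ℝ B = b) (hA : Module.finrank ℝ A = a)
    {e : Fin a → EuclideanSpace ℝ (Fin d)} (he : Orthonormal ℝ e)
    (hspan : Submodule.span ℝ (Set.range e) = A) (hca : c ≤ a) {ω γ κ : ℝ} (hω : 0 < ω)
    (hγ : 0 ≤ γ) (hγω : γ ≤ ω) (hκ : 0 < κ) (h : IsBadlyApproximable B ω κ)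
    (hexp : b * (1 - γ / ω) < (b - c) * (1 + γ)) {M : ℝ} (hM : 0 ≤ M) :
    ∀ᵐ Θ ∂(volume : Measure (Fin (a - c) → Fin c → ℝ)), (∀ i j, |Θ i j| ≤ M) →
      ∃ κ' > 0, IsBadlyApproximable (graphSub d a c hca e Θ) γ κ' := by
  obtain ⟨K, hK, κ₀, hκ₀, hvol⟩ := exists_volume_graphSub_le hca hc he hM
  set κ' := min (min 1 κ₀) (κ * 4 ^ (-ω) / 3)
  have hκ' : 0 < κ' := by positivity
  have hκ1 : κ' ≤ 1 := (min_le_left _ _).trans (min_le_left _ _)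
  have hκ2 : κ' ≤ κ₀ := (min_le_left _ _).trans (min_le_right _ _)
  set E : ℕ → Set (Fin (a - c) → Fin c → ℝ) := fun k => {Θ | (∀ i j, |Θ i j| ≤ M) ∧
    ∃ z : Fin d → ℤ, 2 ^ k ≤ ‖z‖ ∧ ‖z‖ ≤ 2 * 2 ^ k ∧ Metric.infDist (intVec z)
      (graphSub d a c hca e Θ : Set (EuclideanSpace ℝ (Fin d))) <
        κ' * ((2 : ℝ) ^ k) ^ (-γ)}
  set D : ℝ := (15 * d ^ 2) ^ b * (15 * d ^ 2 / κ') ^ (a - b) * (K * κ') ^ (a - c)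
  set s : ℝ := b * (1 - γ / ω) - (b - c) * (1 + γ) with hs
  have hmeas : ∀ k, volume (E k) ≤ ENNReal.ofReal (D * ((2 : ℝ) ^ s) ^ k) := fun k => by
    set T : ℝ := 2 ^ k with hT
    have hT1 : 1 ≤ T := one_le_pow₀ (by norm_num)
    have hT0 : 0 < T := by linarith
    set η := κ' * T ^ (-γ) with hη
    have hη0 : 0 < η := by positivity
    have hTγ : T ^ (-γ) ≤ 1 := Real.rpow_le_one_of_one_le_of_nonpos hT1 (by linarith)
    have hηκ : η ≤ κ' := by nlinarith
    set R := T ^ (γ / ω) with hR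
    have hR1 : 1 ≤ R := Real.one_le_rpow hT1 (by positivity)
    have hRT : R ≤ T := by
      have := Real.rpow_le_rpow_of_exponent_le hT1 ((div_le_one hω).2 hγω)
      rwa [Real.rpow_one] at this
    have hRω : R ^ (-ω) = T ^ (-γ) := by
      rw [hR, ← Real.rpow_mul hT0.le]; congr 1; field_simp
    have hfin : {z : Fin d → ℤ | T ≤ ‖z‖ ∧ ‖z‖ ≤ 2 * T ∧ Metric.infDist (intVec z)
        (A : Set (EuclideanSpace ℝ (Fin d))) < η}.Finite :=
      (finite_setOf_norm_le (2 * T)).subset fun z hz => hz.2.1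
    set S := hfin.toFinset
    have hcard := card_le_of_separated hBA hB hA S hη0 (hηκ.trans (hκ1.trans hR1)) hRT
      (fun w hw hwR => by
        rw [hη, ← hRω]
        exact h.le_infDist hω.le hκ (by linarith) (min_le_right _ _) hw hwR)
      (fun z hz => (hfin.mem_toFinset.1 hz).2)
    have hsub : E k ⊆ ⋃ z ∈ S, {Θ : Fin (a - c) → Fin c → ℝ | (∀ i j, |Θ i j| ≤ M) ∧
        Metric.infDist (intVec z)
          (graphSub d a c hca e Θ : Set (EuclideanSpace ℝ (Fin d))) < η} := by
      rintro Θ ⟨hΘ, z, hz1, hz2, hz3⟩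
      refine Set.mem_iUnion₂.2 ⟨z, hfin.mem_toFinset.2 ⟨hz1, hz2, ?_⟩, hΘ, hz3⟩
      refine (Metric.infDist_le_infDist_of_subset ?_ ⟨0, Submodule.zero_mem _⟩).trans_lt hz3
      exact hspan ▸ graphSub_le hca e Θ
    have hone : ∀ z ∈ S, volume {Θ : Fin (a - c) → Fin c → ℝ | (∀ i j, |Θ i j| ≤ M) ∧
        Metric.infDist (intVec z)
          (graphSub d a c hca e Θ : Set (EuclideanSpace ℝ (Fin d))) < η} ≤
        ENNReal.ofReal ((K * (η / T)) ^ (a - c)) := fun z hz => by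
      have hz1 : T ≤ ‖z‖ := (hfin.mem_toFinset.1 hz).1
      refine (hvol z (norm_pos_iff.1 (hT0.trans_le hz1)) η (hηκ.trans hκ2)).trans ?_
      rw [ENNReal.ofReal_pow (by positivity)]
      gcongr
    have hTR : T / R = T ^ (1 - γ / ω) := by
      rw [hR, Real.rpow_sub hT0, Real.rpow_one]
    have hTη : T / η = T ^ (1 + γ) / κ' := by
      rw [hη, Real.rpow_neg hT0.le, Real.rpow_add hT0, Real.rpow_one]; field_simp
    have hηT : η / T = κ' / T ^ (1 + γ) := by
      rw [← inv_div, hTη, inv_div]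
    have hsum : (T ^ (1 - γ / ω)) ^ b / (T ^ (1 + γ)) ^ (b - c) = ((2 : ℝ) ^ s) ^ k := by
      rw [← Real.rpow_natCast _ b, ← Real.rpow_natCast _ (b - c), ← Real.rpow_natCast _ k,
        ← Real.rpow_mul hT0.le, ← Real.rpow_mul hT0.le, ← Real.rpow_sub hT0, hT,
        ← Real.rpow_natCast 2 k, ← Real.rpow_mul zero_le_two, ← Real.rpow_mul zero_le_two,
        Nat.cast_sub hcb.le, hs]
      congr 1; ring
    calc volume (E k) ≤ _ := measure_mono hsub
      _ ≤ ∑ z ∈ S, _ := measure_biUnion_finset_le _ _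
      _ ≤ S.card • ENNReal.ofReal ((K * (η / T)) ^ (a - c)) := Finset.sum_le_card_nsmul _ _ _ hone
      _ = ENNReal.ofReal (S.card * (K * (η / T)) ^ (a - c)) := by
          rw [ENNReal.ofReal_mul (Nat.cast_nonneg _), ENNReal.ofReal_natCast, nsmul_eq_mul]
      _ ≤ ENNReal.ofReal (D * ((2 : ℝ) ^ s) ^ k) := by
          refine ENNReal.ofReal_le_ofReal ?_
          refine (mul_le_mul_of_nonneg_right hcard (by positivity)).trans (le_of_eq ?_)
          rw [hTR, hTη, hηT, ← hsum]
          have hac : a - c = (a - b) + (b - c) := by omega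
          simp only [D, hac]
          exact count_mul_measure_eq _ _ _ _ (by positivity) _ _ _
  have hrat : (2 : ℝ) ^ s < 1 := Real.rpow_lt_one_of_one_lt_of_neg (by norm_num) (by linarith)
  have hsummable : Summable fun k => D * ((2 : ℝ) ^ s) ^ k :=
    (summable_geometric_of_lt_one (by positivity) hrat).mul_left D
  have htsum : ∑' k, volume (E k) ≠ ⊤ :=
    ne_top_of_le_ne_top hsummable.tsum_ofReal_ne_top (ENNReal.tsum_le_tsum hmeas)
  filter_upwards [ae_eventually_notMem htsum] with Θ hΘ hΘM
  obtain ⟨k₀, hk₀⟩ := eventually_atTop.1 hΘ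
  refine IsBadlyApproximable.of_large hκ' (n := 2 ^ k₀) (by positivity) fun z hz => ?_
  push_cast at hz
  obtain ⟨k, hk1, hk2⟩ := exists_nat_pow_near
    ((one_le_pow₀ (one_le_two : (1 : ℝ) ≤ 2)).trans hz) one_lt_two
  have hk : k₀ ≤ k := by
    have := (pow_lt_pow_iff_right₀ (one_lt_two : (1 : ℝ) < 2)).1 (hz.trans_lt hk2)
    omega
  by_contra! hcon
  refine hk₀ k hk ⟨hΘM, z, hk1, by rw [pow_succ] at hk2; linarith, hcon.trans_le ?_⟩
  gcongr κ' * ?_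
  exact Real.rpow_le_rpow_of_nonpos (by positivity) hk1 (by linarith)

theorem ae_diophExp_graphSub_le {d a b c : ℕ} [NeZero d] (hc : 1 ≤ c) (hcb : c < b)
    (hba : b ≤ a) {A B : Submodule ℝ (EuclideanSpace ℝ (Fin d))} (hBA : B ≤ A)
    (hB : Module.finrank ℝ B = b) (hA : Module.finrank ℝ A = a)
    {e : Fin a → EuclideanSpace ℝ (Fin d)} (he : Orthonormal ℝ e)
    (hspan : Submodule.span ℝ (Set.range e) = A) (hca : c ≤ a) {ω γ κ : ℝ} (hω : 0 < ω)
    (hγ : 0 ≤ γ) (hγω : γ ≤ ω) (hκ : 0 < κ) (h : IsBadlyApproximable B ω κ)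
    (hexp : b * (1 - γ / ω) < (b - c) * (1 + γ)) :
    ∀ᵐ Θ ∂(volume : Measure (Fin (a - c) → Fin c → ℝ)),
      diophExp (graphSub d a c hca e Θ) ≤ γ := by
  have hall := ae_all_iff.2 fun m : ℕ => ae_isBadlyApproximable_of_bounded hc hcb hba hBA hB hA he
    hspan hca hω hγ hγω hκ h hexp (Nat.cast_nonneg m : (0 : ℝ) ≤ m)
  filter_upwards [hall] with Θ hΘ
  obtain ⟨m, hm⟩ := exists_nat_ge ‖Θ‖
  obtain ⟨κ', hκ', hb⟩ := hΘ m fun i j =>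
    ((norm_le_pi_norm (Θ i) j).trans (norm_le_pi_norm Θ i)).trans hm
  exact diophExp_le_of_isBadlyApproximable hγ hκ' hb

theorem exponent_lt {d b c ω γ : ℝ} (hc : 0 ≤ c) (hcb : c < b) (hbd : b < d) (hω : 0 < ω)
    (hdir : b ≤ ω * (d - b)) (hγ : ω + (ω + 1) * (c - b) / (d - c) < γ) :
    b * (1 - γ / ω) < (b - c) * (1 + γ) := by
  have hE : 0 < d - c := by linarith
  have h1 : 0 < γ * (d - c) - (ω * (d - c) + (ω + 1) * (c - b)) := by
    have := mul_lt_mul_of_pos_right hγ hE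
    rw [add_mul, div_mul_cancel₀ _ hE.ne'] at this
    linarith
  have h2 : b * (1 - γ / ω) = b * (ω - γ) / ω := by field_simp
  rw [h2, div_lt_iff₀ hω]
  set δ := γ * (d - c) - (ω * (d - c) + (ω + 1) * (c - b)) with hδ
  have h3 : ((b - c) * (1 + γ) * ω - b * (ω - γ)) * (d - c) =
      (b - c) * (ω + 1) * (ω * (d - b) - b) + (b - c) * ω * δ + b * δ := by
    rw [hδ]; ring
  have h4 : 0 ≤ (b - c) * (ω + 1) * (ω * (d - b) - b) :=
    mul_nonneg (mul_nonneg (by linarith) (by linarith)) (by linarith)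
  have h5 : 0 < (b - c) * ω * δ := mul_pos (mul_pos (by linarith) hω) h1
  have h6 : 0 < b * δ := mul_pos (by linarith) h1
  have := pos_of_mul_pos_left (a := (b - c) * (1 + γ) * ω - b * (ω - γ)) (b := d - c)
    (by linarith) hE.le
  linarith

/-- if `B ⊆ A ⊆ ℝ^d` with `dim B = b`, `dim A = a`, `1 ≤ c < b ≤ a ≤ d`,
`b < d`, and the Diophantine exponent of `B` equals the finite real number `ω`, then for
almost every `Θ` the graph subspace `C(Θ) ⊆ A` satisfies
`ω(C(Θ)) ≤ ω + (ω+1)(c−b)/(d−c)`. -/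
theorem stmt_0 (d a b c : ℕ) (hd : 2 ≤ d) (hc : 1 ≤ c) (hcb : c < b) (hba : b ≤ a)
    (had : a ≤ d) (hbd : b < d)
    (A B : Submodule ℝ (EuclideanSpace ℝ (Fin d))) (hBA : B ≤ A)
    (hdimB : Module.finrank ℝ B = b) (hdimA : Module.finrank ℝ A = a)
    (e : Fin a → EuclideanSpace ℝ (Fin d)) (he : Orthonormal ℝ e)
    (hspan : Submodule.span ℝ (Set.range e) = A)
    (ω : ℝ) (hω : diophExp B = (ω : EReal)) :
    ∀ᵐ Θ ∂(volume : Measure (Fin (a - c) → Fin c → ℝ)),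
      diophExp (graphSub d a c (by omega) e Θ) ≤
        ((ω + (ω + 1) * ((c : ℝ) - (b : ℝ)) / ((d : ℝ) - (c : ℝ)) : ℝ) : EReal) := by
  have : NeZero d := ⟨by omega⟩
  have hc0 : (0 : ℝ) < c := by exact_mod_cast hc
  have hcb' : (c : ℝ) < b := by exact_mod_cast hcb
  have hbd' : (b : ℝ) < d := by exact_mod_cast hbd
  have hD : (0 : ℝ) < d - b := by linarith
  have hE : (0 : ℝ) < d - c := by linarith
  have hdir : ∀ ω' : ℝ, 0 ≤ ω' → ω < ω' → (b : ℝ) ≤ ω' * (d - b) := fun ω' h0 h => by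
    obtain ⟨κ, hκ, hb⟩ := exists_isBadlyApproximable (B := B) (γ := ω')
      (by rw [hω]; exact_mod_cast h)
    exact hb.le_exponent h0 hκ hdimB hbd.le
  have hpos : (0 : ℝ) < b / (d - b) := div_pos (hc0.trans hcb') hD
  have hω0 : b / (d - b) ≤ ω := by
    by_contra! hcon
    obtain ⟨ω', h1, h2⟩ := exists_between (max_lt hcon hpos)
    have h3 := hdir ω' ((le_max_right _ _).trans h1.le) ((le_max_left _ _).trans_lt h1)
    rw [← div_le_iff₀ hD] at h3
    linarith
  have hωb : (b : ℝ) ≤ ω * (d - b) := (div_le_iff₀ hD).1 hω0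
  have hωpos : 0 < ω := hpos.trans_le hω0
  set β : ℝ → ℝ := fun x => x + (x + 1) * (c - b) / (d - c) with hβ
  have hβE : ∀ x, β x * (d - c) = x * (d - b) - (b - c) := fun x => by
    rw [hβ]; field_simp; ring
  have hβ0 : 0 < β ω := by
    refine pos_of_mul_pos_left (b := (d : ℝ) - c) ?_ hE.le
    rw [hβE]; linarith
  have hae : ∀ δ : ℝ, 0 < δ → ∀ᵐ Θ ∂(volume : Measure (Fin (a - c) → Fin c → ℝ)),
      diophExp (graphSub d a c (by omega) e Θ) ≤ ((β ω + δ : ℝ) : EReal) := fun δ hδ => by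
    have hlt : ω < ω + δ / 2 := by linarith
    obtain ⟨κ, hκ, hb⟩ := exists_isBadlyApproximable (B := B) (γ := ω + δ / 2)
      (by rw [hω]; exact_mod_cast hlt)
    have hβ1 : β (ω + δ / 2) < ω + δ / 2 := by
      refine lt_of_mul_lt_mul_right ?_ hE.le
      rw [hβE]
      nlinarith
    have hβ2 : β (ω + δ / 2) < β ω + δ := by
      refine lt_of_mul_lt_mul_right ?_ hE.le
      rw [hβE, add_mul (β ω), hβE]
      nlinarith
    have hβ3 : β ω < β (ω + δ / 2) := by
      refine lt_of_mul_lt_mul_right ?_ hE.le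
      rw [hβE, hβE]
      nlinarith
    obtain ⟨γ, hγ1, hγ2⟩ := exists_between (lt_min hβ1 hβ2)
    filter_upwards [ae_diophExp_graphSub_le hc hcb hba hBA hdimB hdimA he hspan (hcb.le.trans hba)
      (hωpos.trans hlt) (hβ0.trans (hβ3.trans hγ1)).le (hγ2.trans_le (min_le_left _ _)).le hκ hb
      (exponent_lt hc0.le hcb' hbd' (hωpos.trans hlt) (hdir _ (by linarith) hlt) hγ1)] with Θ hΘ
    exact hΘ.trans (EReal.coe_le_coe_iff.2 (hγ2.trans_le (min_le_right _ _)).le)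
  have hall := ae_all_iff.2 fun n : ℕ => hae (1 / (n + 1)) Nat.one_div_pos_of_nat
  filter_upwards [hall] with Θ hΘ
  refine EReal.le_of_forall_lt_iff_le.1 fun z hz => ?_
  have hz' : β ω < z := EReal.coe_lt_coe_iff.1 hz
  obtain ⟨n, hn⟩ := exists_nat_one_div_lt (sub_pos.2 hz')
  exact (hΘ n).trans (EReal.coe_le_coe_iff.2 (by linarith))

end
end

section
/- Let B ⊆ A be linear subspaces of ℝ^d with dim B = b ≥ 1 and dim A = a, b ≤ a ≤ d, and let ψ, φ : [1,∞) → (0,∞) be decreasing functions with ψ(T) ≤ 1 for all T. Then there is a constant κ > 0 depending only on d such that for every T ≥ 1 the set Π_T can be covered by at most κ·μ_T translates of (1/2)Ω_T, where μ_T = (T/ψ(T))^{a−b} · max{1, (φ(T)/ψ(T))^{d−a}}. -/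
open MeasureTheory Filter

noncomputable section

/-- `μ_T = (T/ψ(T))^{a−b} · max{1, (φ(T)/ψ(T))^{d−a}}` for `T ≥ 1`, and `μ_T = 0` for `T < 1`. -/
def muF (a b d : ℕ) (ψ φ : ℝ → ℝ) (T : ℝ) : ℝ :=
  if T < 1 then 0 else (T / ψ T) ^ (a - b) * max 1 ((φ T / ψ T) ^ (d - a))

/-- `M_T = Σ_{j=0}^{⌊log₂ T⌋} μ_{T/2^j}` for integers `T ≥ 1` (and `M_0 = 0`). -/
def MF (a b d : ℕ) (ψ φ : ℝ → ℝ) (T : ℕ) : ℝ :=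
  ∑ j ∈ Finset.range (Nat.log 2 T + 1), muF a b d ψ φ ((T : ℝ) / 2 ^ j)

/-- `λ_T = M_T − M_{T−1}` for integers `T ≥ 1`. -/
def lamF (a b d : ℕ) (ψ φ : ℝ → ℝ) (T : ℕ) : ℝ :=
  MF a b d ψ φ T - MF a b d ψ φ (T - 1)

theorem abs_le_supNorm {d : ℕ} (w : EuclideanSpace ℝ (Fin d)) (i : Fin d) :
    |w i| ≤ supNorm w :=
  le_ciSup (f := fun i => |w i|) (Set.finite_range _).bddAbove i

theorem supNorm_le_norm {d : ℕ} (w : EuclideanSpace ℝ (Fin d)) : supNorm w ≤ ‖w‖ :=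
  Real.iSup_le (fun i => PiLp.norm_apply_le w i) (norm_nonneg w)

theorem norm_le_mul_supNorm {d : ℕ} (w : EuclideanSpace ℝ (Fin d)) :
    ‖w‖ ≤ d * supNorm w := by
  have hb := (EuclideanSpace.basisFun (Fin d) ℝ).sum_repr w
  calc ‖w‖ = ‖∑ i, (EuclideanSpace.basisFun (Fin d) ℝ).repr w i •
        EuclideanSpace.basisFun (Fin d) ℝ i‖ := by rw [hb]
    _ ≤ ∑ i : Fin d, |w i| := (norm_sum_le _ _).trans_eq (by simp [norm_smul])
    _ ≤ ∑ _i : Fin d, supNorm w := Finset.sum_le_sum fun i _ => abs_le_supNorm w i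
    _ = d * supNorm w := by simp

section Covering

variable {E : Type*} [NormedAddCommGroup E] [InnerProductSpace ℝ E]

/-- The distance to a subspace is realised by the orthogonal projection. -/
theorem norm_sub_starProjection_eq_infDist (K : Submodule ℝ E) [K.HasOrthogonalProjection]
    (w : E) : ‖w - K.starProjection w‖ = Metric.infDist w (K : Set E) := by
  rw [Submodule.starProjection_minimal, Metric.infDist_eq_iInf]
  simp only [dist_eq_norm]
  rfl

/-- A ball of radius `R` in a subspace of dimension at most `m` is covered by a grid of at most
`(2 m R / r + 3) ^ dim` balls of radius `r`. -/
theorem exists_finset_cover_ball (V : Submodule ℝ E) [FiniteDimensional ℝ V] {m : ℕ}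
    (hm : Module.finrank ℝ V ≤ m) (hm0 : 0 < m) {R r : ℝ} (hR : 0 ≤ R) (hr : 0 < r) :
    ∃ F : Finset E, (F.card : ℝ) ≤ (2 * m * R / r + 3) ^ Module.finrank ℝ V ∧
      ∀ x ∈ V, ‖x‖ ≤ R → ∃ v ∈ F, v ∈ V ∧ ‖x - v‖ ≤ r := by
  classical
  set n := Module.finrank ℝ V with hn
  have hm' : (0 : ℝ) < m := by exact_mod_cast hm0
  let e : OrthonormalBasis (Fin n) ℝ V := stdOrthonormalBasis ℝ V
  set s : ℝ := r / m with hs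
  have hs0 : 0 < s := by positivity
  let N : ℕ := ⌈R / s⌉₊
  let c : (Fin n → ℤ) → E := fun k => ((∑ i, ((k i : ℝ) * s) • e i : V) : E)
  refine ⟨(Fintype.piFinset fun _ : Fin n => Finset.Icc (-(N : ℤ)) N).image c, ?_, ?_⟩
  · have h1 := Finset.card_image_le (s := Fintype.piFinset fun _ : Fin n =>
      Finset.Icc (-(N : ℤ)) N) (f := c)
    have h2 : (Fintype.piFinset fun _ : Fin n => Finset.Icc (-(N : ℤ)) N).card
        = (2 * N + 1) ^ n := by
      rw [Fintype.card_piFinset]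
      simp only [Int.card_Icc, Finset.prod_const, Finset.card_univ, Fintype.card_fin]
      congr 1
      omega
    rw [h2] at h1
    have h3 : (N : ℝ) < R / s + 1 := Nat.ceil_lt_add_one (by positivity)
    have h4 : 2 * m * R / r = 2 * (R / s) := by rw [hs]; field_simp
    calc _ ≤ (((2 * N + 1) ^ n : ℕ) : ℝ) := by exact_mod_cast h1
      _ = (2 * (N : ℝ) + 1) ^ n := by push_cast; rfl
      _ ≤ _ := by
        rw [h4]
        exact pow_le_pow_left₀ (by positivity) (by linarith) _
  · intro x hx hxR
    set y : V := ⟨x, hx⟩ with hy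
    let k : Fin n → ℤ := fun i => ⌊e.repr y i / s⌋
    refine ⟨c k, Finset.mem_image_of_mem _ ?_, Submodule.coe_mem _, ?_⟩
    · rw [Fintype.mem_piFinset]
      intro i
      have h1 : |e.repr y i| ≤ R := by
        calc |e.repr y i| ≤ ‖e.repr y‖ := PiLp.norm_apply_le (e.repr y) i
          _ = ‖y‖ := e.repr.norm_map y
          _ ≤ R := hxR
      have h2 : R / s ≤ N := Nat.le_ceil _
      have h3 : |e.repr y i / s| ≤ N := by
        rw [abs_div, abs_of_pos hs0]
        exact (by gcongr : |e.repr y i| / s ≤ R / s).trans h2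
      obtain ⟨h4, h5⟩ := abs_le.mp h3
      rw [Finset.mem_Icc]
      constructor
      · exact Int.le_floor.2 (by push_cast; exact h4)
      · have h6 : ((k i : ℤ) : ℝ) ≤ N := (Int.floor_le (e.repr y i / s)).trans h5
        exact_mod_cast h6
    · have h1 : x - c k = ((∑ i, (e.repr y i - k i * s) • e i : V) : E) := by
        simp only [sub_smul, Finset.sum_sub_distrib, e.sum_repr]
        simp [c, hy]
      have h2 : ∀ i, ‖(e.repr y i - k i * s) • e i‖ ≤ s := by
        intro i
        rw [norm_smul, e.norm_eq_one, mul_one, Real.norm_eq_abs]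
        have h4 : e.repr y i - k i * s = (e.repr y i / s - k i) * s := by field_simp
        rw [h4, abs_mul, abs_of_pos hs0]
        have h5 : |e.repr y i / s - k i| ≤ 1 := by
          rw [abs_of_nonneg (sub_nonneg.2 (Int.floor_le _))]
          linarith [Int.lt_floor_add_one (e.repr y i / s)]
        nlinarith
      rw [h1, ← Submodule.coe_norm]
      calc _ ≤ ∑ i, ‖(e.repr y i - k i * s) • e i‖ := norm_sum_le _ _
        _ ≤ ∑ _i : Fin n, s := Finset.sum_le_sum fun i _ => h2 i
        _ = n * s := by simp
        _ ≤ m * s := by gcongr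
        _ = r := by rw [hs]; field_simp

end Covering

/-- Lemma 1 of the paper: there is a constant `κ > 0` depending only on `d` such
that for all subspaces `B ⊆ A` of `ℝ^d` with `dim B = b ≥ 1`, `dim A = a`, `b ≤ a ≤ d`, all
positive decreasing `ψ, φ` with `ψ ≤ 1`, and every `T ≥ 1`, the set
`Π_T = {w : |w| ≤ T, dist(w,A) ≤ φ(T)}` can be covered by at most `κ·μ_T` translates of
`(1/2)Ω_T`, where `Ω_T = {w : |w| ≤ T, dist(w,B) ≤ ψ(T)}`. -/
theorem stmt_3 (d : ℕ) :
    ∃ κ : ℝ, 0 < κ ∧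
      ∀ (a b : ℕ) (B A : Submodule ℝ (EuclideanSpace ℝ (Fin d))) (ψ φ : ℝ → ℝ),
        1 ≤ b → b ≤ a → a ≤ d → B ≤ A →
        Module.finrank ℝ B = b → Module.finrank ℝ A = a →
        (∀ T : ℝ, 1 ≤ T → 0 < ψ T) → (∀ T : ℝ, 1 ≤ T → 0 < φ T) →
        AntitoneOn ψ (Set.Ici 1) → AntitoneOn φ (Set.Ici 1) →
        (∀ T : ℝ, 1 ≤ T → ψ T ≤ 1) →
        ∀ T : ℝ, 1 ≤ T →
          ∃ F : Finset (EuclideanSpace ℝ (Fin d)),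
            (F.card : ℝ) ≤ κ * muF a b d ψ φ T ∧
            {w : EuclideanSpace ℝ (Fin d) | supNorm w ≤ T ∧
                Metric.infDist w (A : Set (EuclideanSpace ℝ (Fin d))) ≤ φ T} ⊆
              ⋃ v ∈ F, (fun w => (2⁻¹ : ℝ) • w + v) ''
                {w : EuclideanSpace ℝ (Fin d) | supNorm w ≤ T ∧
                  Metric.infDist w (B : Set (EuclideanSpace ℝ (Fin d))) ≤ ψ T} := by
  classical
  refine ⟨(32 * (d : ℝ) ^ 2 + 3) ^ d, by positivity, ?_⟩
  intro a b B A ψ φ hb hba had hBA hB hA hψ hφ _ _ hψ1 T hT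
  set p := ψ T with hp
  set f := φ T with hf
  set K : ℝ := 32 * (d : ℝ) ^ 2 + 3 with hK
  have hp0 : 0 < p := hψ T hT
  have hf0 : 0 < f := hφ T hT
  have hp1 : p ≤ 1 := hψ1 T hT
  have hd : 0 < d := by omega
  have hC : Module.finrank ℝ ↥(Bᗮ ⊓ A) = a - b := by
    have := Submodule.finrank_add_inf_finrank_orthogonal hBA
    omega
  have hD : Module.finrank ℝ ↥Aᗮ = d - a := by
    have := Submodule.finrank_add_finrank_orthogonal A
    rw [finrank_euclideanSpace_fin] at this
    omega
  obtain ⟨F₁, hF₁, hc₁⟩ := exists_finset_cover_ball B (m := d) (by omega) hd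
    (R := d * T) (r := T / 4) (by positivity) (by positivity)
  obtain ⟨F₂, hF₂, hc₂⟩ := exists_finset_cover_ball (Bᗮ ⊓ A) (m := d) (by omega) hd
    (R := 2 * (d * T)) (r := p / 8) (by positivity) (by positivity)
  obtain ⟨F₃, hF₃, hc₃⟩ := exists_finset_cover_ball Aᗮ (m := d) (by omega) hd
    (R := f) (r := p / 8) (by positivity) (by positivity)
  rw [hB] at hF₁
  rw [hC] at hF₂
  rw [hD] at hF₃
  refine ⟨Finset.image₂ (· + ·) (Finset.image₂ (· + ·) F₁ F₂) F₃, ?_, ?_⟩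
  · have hcard : (Finset.image₂ (· + ·) (Finset.image₂ (· + ·) F₁ F₂) F₃).card
        ≤ F₁.card * F₂.card * F₃.card :=
      (Finset.card_image₂_le _ _ _).trans
        (Nat.mul_le_mul_right _ (Finset.card_image₂_le _ _ _))
    have h₁ : (F₁.card : ℝ) ≤ K ^ b := by
      refine hF₁.trans (pow_le_pow_left₀ (by positivity) ?_ _)
      have : 2 * d * (d * T) / (T / 4) = 8 * (d : ℝ) ^ 2 := by field_simp; ring
      rw [this, hK]
      nlinarith [sq_nonneg (d : ℝ)]
    have h₂ : (F₂.card : ℝ) ≤ K ^ (a - b) * (T / p) ^ (a - b) := by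
      rw [← mul_pow]
      refine hF₂.trans (pow_le_pow_left₀ (by positivity) ?_ _)
      have h1 : 2 * d * (2 * (d * T)) / (p / 8) = 32 * (d : ℝ) ^ 2 * (T / p) := by
        field_simp; ring
      have h2 : 1 ≤ T / p := (one_le_div hp0).2 (hp1.trans hT)
      rw [h1, hK]
      linarith
    have h₃ : (F₃.card : ℝ) ≤ K ^ (d - a) * max 1 ((f / p) ^ (d - a)) := by
      have hmax : max 1 ((f / p) ^ (d - a)) = (max 1 (f / p)) ^ (d - a) := by
        rcases le_total 1 (f / p) with h | h
        · rw [max_eq_right h, max_eq_right (one_le_pow₀ h)]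
        · rw [max_eq_left h, max_eq_left (pow_le_one₀ (by positivity) h), one_pow]
      rw [hmax, ← mul_pow]
      refine hF₃.trans (pow_le_pow_left₀ (by positivity) ?_ _)
      have h1 : 2 * d * f / (p / 8) = 16 * (d : ℝ) * (f / p) := by
        field_simp; ring
      have h2 : (1 : ℝ) ≤ d := by exact_mod_cast hd
      have h3 : 16 * (d : ℝ) * (f / p) ≤ 32 * (d : ℝ) ^ 2 * max 1 (f / p) := by
        have h4 : f / p ≤ max 1 (f / p) := le_max_right _ _
        have h5 : 16 * (d : ℝ) ≤ 32 * (d : ℝ) ^ 2 := by nlinarith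
        gcongr
      rw [h1, hK]
      linarith [le_max_left 1 (f / p)]
    have hKd : K ^ b * K ^ (a - b) * K ^ (d - a) = K ^ d := by
      rw [← pow_add, ← pow_add]
      congr 1
      omega
    rw [muF, if_neg (not_lt.2 hT), ← hp, ← hf]
    calc _ ≤ (F₁.card : ℝ) * F₂.card * F₃.card := by exact_mod_cast hcard
      _ ≤ K ^ b * (K ^ (a - b) * (T / p) ^ (a - b)) *
          (K ^ (d - a) * max 1 ((f / p) ^ (d - a))) := by gcongr
      _ = (K ^ b * K ^ (a - b) * K ^ (d - a)) *
          ((T / p) ^ (a - b) * max 1 ((f / p) ^ (d - a))) := by ring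
      _ = _ := by rw [hKd]
  · rintro w ⟨hwT, hwA⟩
    have hw : ‖w‖ ≤ d * T := (norm_le_mul_supNorm w).trans (by gcongr)
    set x := B.starProjection w with hx
    set y := A.starProjection w with hy
    have hxB : x ∈ B := B.starProjection_apply_mem w
    have hyA : y ∈ A := A.starProjection_apply_mem w
    have hx' : ‖x‖ ≤ d * T := (B.norm_starProjection_apply_le w).trans hw
    have hy' : ‖y‖ ≤ d * T := (A.norm_starProjection_apply_le w).trans hw
    have hwy : w - y ∈ Aᗮ := A.sub_starProjection_mem_orthogonal w
    have hyx : y - x ∈ Bᗮ ⊓ A := by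
      refine ⟨?_, A.sub_mem hyA (hBA hxB)⟩
      have h := Bᗮ.sub_mem (B.sub_starProjection_mem_orthogonal w)
        (Submodule.orthogonal_le hBA hwy)
      rwa [sub_sub_sub_cancel_left] at h
    obtain ⟨v₁, hv₁, hv₁B, he₁⟩ := hc₁ x hxB hx'
    obtain ⟨v₂, hv₂, -, he₂⟩ := hc₂ (y - x) hyx (by linarith [norm_sub_le y x])
    obtain ⟨v₃, hv₃, -, he₃⟩ := hc₃ (w - y) hwy
      (by rw [hy, norm_sub_starProjection_eq_infDist]; exact hwA)
    have he₂₃ := norm_add_le (y - x - v₂) (w - y - v₃)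
    have hsum : w - (v₁ + v₂ + v₃) = (x - v₁) + ((y - x - v₂) + (w - y - v₃)) := by abel
    have he := norm_add_le (x - v₁) ((y - x - v₂) + (w - y - v₃))
    rw [← hsum] at he
    simp only [Set.mem_iUnion]
    refine ⟨v₁ + v₂ + v₃, Finset.mem_image₂_of_mem (Finset.mem_image₂_of_mem hv₁ hv₂) hv₃,
      (2 : ℝ) • (w - (v₁ + v₂ + v₃)), ⟨?_, ?_⟩, ?_⟩
    · refine (supNorm_le_norm _).trans ?_
      rw [norm_smul, Real.norm_ofNat]
      linarith
    · refine (Metric.infDist_le_dist_of_mem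
        (B.smul_mem (2 : ℝ) (B.sub_mem hxB hv₁B))).trans ?_
      rw [dist_eq_norm, ← smul_sub, norm_smul, Real.norm_ofNat, hsum, add_sub_cancel_left]
      linarith
    · simp [smul_smul]

end
end
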